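/- arXiv:2501.12771 — 5 statements merged into one kernel-verified Lean document; each statement's English description precedes it below -/
import Mathlib

section
/- Let V be a finite set, let k ≥ 1, let E be a set of k-element subsets of V (a k-uniform hypergraph) with m = |E| hyperedges and maximum degree Δ = max over v∈V of |{h ∈ E : v ∈ h}|. Let B be a Bernoulli(r) random subset of V for some r ∈ [0,1]. Then for every fixed hyperedge h ∈ E, the probability that h ⊆ B and no other hyperedge h' ∈ E with h' ≠ h satisfies h' ⊆ B is at least (1 − r·k·Δ − m·r^k)·r^k. -/
open MeasureTheory

/-- The Bernoulli(r) measure on `Bool`: `true` with probability `r`,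
`false` with probability `1 - r`. -/
noncomputable def bernoulliMeasure (r : ℝ) : Measure Bool :=
  r.toNNReal • Measure.dirac true + (1 - r).toNNReal • Measure.dirac false

instance (r : ℝ) : IsFiniteMeasure (bernoulliMeasure r) := by
  unfold bernoulliMeasure; infer_instance

/-- The distribution of a Bernoulli(r) random subset of `V`, encoded as the
product measure on `V → Bool` (a vertex `v` belongs to the subset iff the
coordinate at `v` is `true`). -/
noncomputable def bernoulliProduct (V : Type*) [Fintype V] (r : ℝ) :
    Measure (V → Bool) :=
  Measure.pi fun _ => bernoulliMeasure r

/-- Maximum degree of the hypergraph with edge set `E`. -/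
def maxDegree {V : Type*} [Fintype V] [DecidableEq V] (E : Finset (Finset V)) : ℕ :=
  Finset.univ.sup fun v => (E.filter fun e => v ∈ e).card

theorem bernoulliMeasure_singleton_true (r : ℝ) :
    bernoulliMeasure r {true} = ENNReal.ofReal r := by
  simp [bernoulliMeasure, ENNReal.ofReal]

theorem bernoulliMeasure_univ {r : ℝ} (hr0 : 0 ≤ r) (hr1 : r ≤ 1) :
    bernoulliMeasure r Set.univ = 1 := by
  have : ENNReal.ofReal r + ENNReal.ofReal (1 - r) = 1 := by
    rw [← ENNReal.ofReal_add hr0 (sub_nonneg.2 hr1)]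
    simp
  simpa [bernoulliMeasure, ENNReal.ofReal] using this

/-- A Bernoulli(r) random subset contains a fixed set `S` with probability `r ^ |S|`. -/
theorem bernoulliProduct_forall_mem_eq_true {V : Type*} [Fintype V] [DecidableEq V] {r : ℝ}
    (hr0 : 0 ≤ r) (hr1 : r ≤ 1) (S : Finset V) :
    bernoulliProduct V r {f | ∀ v ∈ S, f v = true} = ENNReal.ofReal (r ^ S.card) := by
  have hpi : {f : V → Bool | ∀ v ∈ S, f v = true} =
      Set.univ.pi fun v => if v ∈ S then {true} else Set.univ := by
    ext f
    simp only [Set.mem_ofPred_eq, Set.mem_univ_pi]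
    refine forall_congr' fun v => ?_
    by_cases hv : v ∈ S <;> simp [hv]
  have hval (v : V) : bernoulliMeasure r (if v ∈ S then {true} else Set.univ) =
      if v ∈ S then ENNReal.ofReal r else 1 := by
    split_ifs
    · exact bernoulliMeasure_singleton_true r
    · exact bernoulliMeasure_univ hr0 hr1
  rw [hpi, bernoulliProduct, Measure.pi_pi]
  simp only [hval]
  rw [Finset.prod_ite_mem, Finset.univ_inter, Finset.prod_const, ENNReal.ofReal_pow hr0]

theorem card_filter_mem_le_maxDegree {V : Type*} [Fintype V] [DecidableEq V]
    (E : Finset (Finset V)) (v : V) :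
    (E.filter fun e => v ∈ e).card ≤ maxDegree E :=
  Finset.le_sup (f := fun v => (E.filter fun e => v ∈ e).card) (Finset.mem_univ v)

/-- The sizes of the intersections of the hyperedges with a vertex set `h` add up to at most
`|h|` times the maximum degree. -/
theorem sum_card_inter_le_card_mul_maxDegree {V : Type*} [Fintype V] [DecidableEq V]
    (E : Finset (Finset V)) (h : Finset V) :
    ∑ e ∈ E, (h ∩ e).card ≤ h.card * maxDegree E := by
  calc ∑ e ∈ E, (h ∩ e).card = ∑ v ∈ h, (E.filter fun e => v ∈ e).card := by
        simp only [← Finset.filter_mem_eq_inter, Finset.card_filter]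
        exact Finset.sum_comm
    _ ≤ h.card * maxDegree E :=
        Finset.sum_le_card_nsmul _ _ _ fun v _ => card_filter_mem_le_maxDegree E v

/-- For distinct sets of size `k`, either they meet and their union has more than `k` elements,
or they are disjoint and their union has `2 * k` elements. -/
theorem pow_card_union_le {V : Type*} [DecidableEq V] {k : ℕ} {r : ℝ}
    (hr0 : 0 ≤ r) (hr1 : r ≤ 1) {h e : Finset V} (hh : h.card = k) (he : e.card = k)
    (hne : e ≠ h) :
    r ^ (h ∪ e).card ≤ r ^ (k + 1) * ((h ∩ e).card : ℝ) + r ^ (2 * k) := by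
  have hcard := Finset.card_union_add_card_inter h e
  rcases Nat.eq_zero_or_pos (h ∩ e).card with h0 | hpos
  · have hu : (h ∪ e).card = 2 * k := by omega
    simp [h0, hu]
  · have hlt : k < (h ∪ e).card := by
      by_contra hle
      have h1 : h = h ∪ e := Finset.eq_of_subset_of_card_le Finset.subset_union_left (by omega)
      have h2 : e = h ∪ e := Finset.eq_of_subset_of_card_le Finset.subset_union_right (by omega)
      exact hne (h2.trans h1.symm)
    have h1 : (1 : ℝ) ≤ ((h ∩ e).card : ℝ) := by exact_mod_cast hpos
    calc r ^ (h ∪ e).card ≤ r ^ (k + 1) := pow_le_pow_of_le_one hr0 hr1 hlt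
      _ ≤ r ^ (k + 1) * ((h ∩ e).card : ℝ) := le_mul_of_one_le_right (by positivity) h1
      _ ≤ _ := le_add_of_nonneg_right (by positivity)

theorem sum_pow_card_union_le {V : Type*} [Fintype V] [DecidableEq V] {k : ℕ}
    {E : Finset (Finset V)} (hunif : ∀ e ∈ E, e.card = k) {r : ℝ} (hr0 : 0 ≤ r) (hr1 : r ≤ 1)
    {h : Finset V} (hh : h ∈ E) :
    ∑ e ∈ E.erase h, r ^ (h ∪ e).card ≤
      r ^ (k + 1) * (k * maxDegree E) + E.card * r ^ (2 * k) := by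
  have hdeg : ∑ e ∈ E, ((h ∩ e).card : ℝ) ≤ k * maxDegree E := by
    rw [← hunif h hh]
    exact_mod_cast sum_card_inter_le_card_mul_maxDegree E h
  calc ∑ e ∈ E.erase h, r ^ (h ∪ e).card
      ≤ ∑ e ∈ E.erase h, (r ^ (k + 1) * ((h ∩ e).card : ℝ) + r ^ (2 * k)) :=
        Finset.sum_le_sum fun e he => pow_card_union_le hr0 hr1 (hunif h hh)
          (hunif e (Finset.mem_of_mem_erase he)) (Finset.ne_of_mem_erase he)
    _ ≤ ∑ e ∈ E, (r ^ (k + 1) * ((h ∩ e).card : ℝ) + r ^ (2 * k)) :=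
        Finset.sum_le_sum_of_subset_of_nonneg (Finset.erase_subset h E)
          fun _ _ _ => by positivity
    _ = r ^ (k + 1) * ∑ e ∈ E, ((h ∩ e).card : ℝ) + E.card * r ^ (2 * k) := by
        rw [Finset.sum_add_distrib, ← Finset.mul_sum, Finset.sum_const, nsmul_eq_mul]
    _ ≤ _ := by gcongr

theorem stmt0 {V : Type*} [Fintype V] [DecidableEq V] (k : ℕ) (hk : 1 ≤ k)
    (E : Finset (Finset V)) (hunif : ∀ e ∈ E, e.card = k)
    (m : ℕ) (hm : m = E.card) (Δ : ℕ) (hΔ : Δ = maxDegree E)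
    (r : ℝ) (hr0 : 0 ≤ r) (hr1 : r ≤ 1)
    (h : Finset V) (hh : h ∈ E) :
    ENNReal.ofReal ((1 - r * k * Δ - m * r ^ k) * r ^ k) ≤
      bernoulliProduct V r
        {f | (∀ v ∈ h, f v = true) ∧
          ∀ h' ∈ E, h' ≠ h → ¬ (∀ v ∈ h', f v = true)} := by
  subst hm hΔ
  set G : Set (V → Bool) := {f | (∀ v ∈ h, f v = true) ∧
    ∀ h' ∈ E, h' ≠ h → ¬ (∀ v ∈ h', f v = true)}
  have hcover : {f : V → Bool | ∀ v ∈ h, f v = true} ⊆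
      G ∪ ⋃ e ∈ E.erase h, {f | ∀ v ∈ h ∪ e, f v = true} := by
    intro f hf
    by_cases hG : f ∈ G
    · exact Or.inl hG
    · obtain ⟨e, he, hne, hfe⟩ : ∃ e ∈ E, e ≠ h ∧ ∀ v ∈ e, f v = true := by
        by_contra hcon
        exact hG ⟨hf, fun e he hne hfe => hcon ⟨e, he, hne, hfe⟩⟩
      exact Or.inr (Set.mem_biUnion (Finset.mem_erase.2 ⟨hne, he⟩) fun v hv =>
        (Finset.mem_union.1 hv).elim (hf v) (hfe v))
  have hunion : ENNReal.ofReal (r ^ k) ≤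
      bernoulliProduct V r G + ENNReal.ofReal (∑ e ∈ E.erase h, r ^ (h ∪ e).card) := by
    rw [← hunif h hh, ← bernoulliProduct_forall_mem_eq_true hr0 hr1,
      ENNReal.ofReal_sum_of_nonneg fun _ _ => by positivity]
    simp only [← bernoulliProduct_forall_mem_eq_true hr0 hr1]
    exact (measure_mono hcover).trans <| (measure_union_le _ _).trans <|
      add_le_add_right (measure_biUnion_finset_le _ _) _
  have hsum := sum_pow_card_union_le hunif hr0 hr1 hh
  calc ENNReal.ofReal ((1 - r * k * maxDegree E - E.card * r ^ k) * r ^ k)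
      ≤ ENNReal.ofReal (r ^ k - ∑ e ∈ E.erase h, r ^ (h ∪ e).card) := by
        refine ENNReal.ofReal_le_ofReal ?_
        have : (1 - r * k * maxDegree E - E.card * r ^ k) * r ^ k =
            r ^ k - (r ^ (k + 1) * (k * maxDegree E) + E.card * r ^ (2 * k)) := by ring
        linarith
    _ = ENNReal.ofReal (r ^ k) - ENNReal.ofReal (∑ e ∈ E.erase h, r ^ (h ∪ e).card) :=
        ENNReal.ofReal_sub _ (Finset.sum_nonneg fun _ _ => by positivity)
    _ ≤ bernoulliProduct V r G := tsub_le_iff_right.2 hunion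
end

section
/- Let k ≥ 1, M = (1/e)·(1 − e^{−1/k}), and δ ∈ (0,1). Let V be a finite set, E a set of k-element subsets of V, and B ⊆ V a set containing exactly one hyperedge of E (exactly one h ∈ E satisfies h ⊆ B). Let S_1, …, S_t be independent Bernoulli(e^{−1/k}) random subsets of B with t ≥ 2·ln(2/δ)/M², and let p̂ = (1/t)·|{i : some hyperedge of E is contained in S_i}|. Then Pr[0 < p̂ < 1/e + M/2] ≥ 1 − δ. -/
open MeasureTheory

/-- **Hoeffding's inequality** for i.i.d. samples of a bounded function, realised on a finite power
of a probability space. -/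
lemma measureReal_pi_sum_ge_le {Ω : Type*} [MeasurableSpace Ω] (μ : Measure Ω)
    [IsProbabilityMeasure μ] {f : Ω → ℝ} (hf : Measurable f) {a b : ℝ}
    (hab : ∀ ω, f ω ∈ Set.Icc a b) (t : ℕ) {s : ℝ} (hs : 0 ≤ s) :
    (Measure.pi fun _ : Fin t => μ).real {g | t * (∫ ω, f ω ∂μ + s) ≤ ∑ i, f (g i)} ≤
      Real.exp (-(2 * t * s ^ 2) / (b - a) ^ 2) := by
  have hind : ProbabilityTheory.iIndepFun
      (fun (i : Fin t) (g : Fin t → Ω) => f (g i) - ∫ ω, f ω ∂μ)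
      (Measure.pi fun _ : Fin t => μ) :=
    ProbabilityTheory.iIndepFun_pi (X := fun _ ω => f ω - ∫ ω, f ω ∂μ)
      fun _ => (hf.sub_const _).aemeasurable
  have hsub : ∀ i ∈ (Finset.univ : Finset (Fin t)), ProbabilityTheory.HasSubgaussianMGF
      (fun g : Fin t → Ω => f (g i) - ∫ ω, f ω ∂μ) ((‖b - a‖₊ / 2) ^ 2)
      (Measure.pi fun _ : Fin t => μ) := by
    intro i _
    have hmp := measurePreserving_eval (fun _ : Fin t => μ) i
    have hX := ProbabilityTheory.hasSubgaussianMGF_of_mem_Icc hf.aemeasurable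
      (ae_of_all μ hab)
    rw [← hmp.map_eq] at hX
    have hX' := hX.of_map hmp.measurable.aemeasurable
    rw [hmp.map_eq] at hX'
    exact hX'
  have key := ProbabilityTheory.HasSubgaussianMGF.measure_sum_ge_le_of_iIndepFun hind hsub
    (ε := t * s) (by positivity)
  have hset : {g : Fin t → Ω | t * s ≤ ∑ i, (f (g i) - ∫ ω, f ω ∂μ)} =
      {g | t * (∫ ω, f ω ∂μ + s) ≤ ∑ i, f (g i)} := by
    ext g
    simp only [Set.mem_ofPred_eq, Finset.sum_sub_distrib, Finset.sum_const, Finset.card_univ,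
      Fintype.card_fin, nsmul_eq_mul, mul_add]
    rw [le_sub_iff_add_le, add_comm]
  rw [hset] at key
  refine key.trans_eq ?_
  congr 1
  rcases Nat.eq_zero_or_pos t with rfl | ht
  · simp
  have ht' : (t : ℝ) ≠ 0 := by positivity
  rcases eq_or_ne (b - a) 0 with h0 | h0
  · simp [h0]
  · simp [div_pow]
    field_simp

lemma isProbabilityMeasure_bernoulliMeasure {r : ℝ} (h0 : 0 ≤ r) (h1 : r ≤ 1) :
    IsProbabilityMeasure (bernoulliMeasure r) := by
  constructor
  simp only [bernoulliMeasure, Measure.add_apply, Measure.smul_apply, measure_univ,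
    ENNReal.smul_def, smul_eq_mul, mul_one]
  rw [← ENNReal.coe_add, ← Real.toNNReal_add h0 (sub_nonneg.2 h1)]
  simp

lemma isProbabilityMeasure_bernoulliProduct (V : Type*) [Fintype V] {r : ℝ} (h0 : 0 ≤ r)
    (h1 : r ≤ 1) : IsProbabilityMeasure (bernoulliProduct V r) := by
  have := isProbabilityMeasure_bernoulliMeasure h0 h1
  unfold bernoulliProduct
  infer_instance

lemma bernoulliProduct_real_forall_mem {V : Type*} [Fintype V] [DecidableEq V] {r : ℝ}
    (h0 : 0 ≤ r) (h1 : r ≤ 1) (h : Finset V) :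
    (bernoulliProduct V r).real {s | ∀ v ∈ h, s v = true} = r ^ h.card := by
  have := isProbabilityMeasure_bernoulliMeasure h0 h1
  have hset : {s : V → Bool | ∀ v ∈ h, s v = true} =
      Set.univ.pi fun v => if v ∈ h then {true} else Set.univ := by
    ext s
    simp only [Set.mem_ofPred_eq, Set.mem_pi, Set.mem_univ, true_implies]
    refine forall_congr' fun v => ?_
    by_cases hv : v ∈ h <;> simp [hv]
  have hone : ∀ v, bernoulliMeasure r (if v ∈ h then {true} else Set.univ) =
      if v ∈ h then ENNReal.ofReal r else 1 := by
    intro v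
    by_cases hv : v ∈ h
    · rw [if_pos hv, if_pos hv]
      simp only [bernoulliMeasure, Measure.add_apply, Measure.smul_apply]
      simp [ENNReal.ofReal, ENNReal.smul_def, -Measure.coe_nnreal_smul]
    · rw [if_neg hv, if_neg hv, measure_univ]
  rw [measureReal_def, hset, bernoulliProduct, Measure.pi_pi]
  simp only [hone, Finset.prod_ite_mem, Finset.univ_inter, Finset.prod_const,
    ENNReal.toReal_pow, ENNReal.toReal_ofReal h0]

/-- Both tails of the empirical frequency of an event, at the same distance `s` from its
probability, have total mass at most `2 * exp (-2 * t * s ^ 2)`. -/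
lemma measureReal_pi_card_tails_le {Ω : Type*} [MeasurableSpace Ω] (μ : Measure Ω)
    [IsProbabilityMeasure μ] {A : Set Ω} (hA : MeasurableSet A) (t : ℕ) {s : ℝ} (hs : 0 ≤ s) :
    (Measure.pi fun _ : Fin t => μ).real
        {g | (Nat.card {i : Fin t // g i ∈ A} : ℝ) ≤ t * (μ.real A - s) ∨
          t * (μ.real A + s) ≤ (Nat.card {i : Fin t // g i ∈ A} : ℝ)} ≤
      2 * Real.exp (-(2 * t * s ^ 2)) := by
  classical
  have hcard : ∀ g : Fin t → Ω, (Nat.card {i : Fin t // g i ∈ A} : ℝ) =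
      ∑ i, A.indicator (1 : Ω → ℝ) (g i) := by
    intro g
    simp [Set.indicator_apply, Fintype.card_subtype]
  have hmeas : Measurable (A.indicator (1 : Ω → ℝ)) := measurable_one.indicator hA
  have hmem : ∀ ω, A.indicator (1 : Ω → ℝ) ω ∈ Set.Icc (0 : ℝ) 1 := by
    intro ω
    by_cases hω : ω ∈ A <;> simp [hω]
  have hmem' : ∀ ω, -A.indicator (1 : Ω → ℝ) ω ∈ Set.Icc (-1 : ℝ) 0 := fun ω =>
    ⟨neg_le_neg (hmem ω).2, neg_nonpos.2 (hmem ω).1⟩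
  have hup := measureReal_pi_sum_ge_le μ hmeas hmem t hs
  have hlow := measureReal_pi_sum_ge_le μ hmeas.neg hmem' t hs
  simp only [Pi.neg_apply, integral_neg, integral_indicator_one hA, Finset.sum_neg_distrib,
    ← hcard] at hup hlow
  simp only [sub_zero, sub_neg_eq_add, zero_add, one_pow, div_one] at hup hlow
  rw [Set.ofPred_or, two_mul]
  refine (measureReal_union_le _ _).trans (add_le_add (le_of_eq_of_le ?_ hlow) hup)
  congr 1
  ext g
  simp only [Set.mem_ofPred_eq]
  constructor <;> intro hg <;> linarith

theorem stmt6 {V : Type*} [Fintype V] [DecidableEq V] (k : ℕ) (hk : 1 ≤ k)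
    (M : ℝ) (hM : M = (1 / Real.exp 1) * (1 - Real.exp (-(1 / (k : ℝ)))))
    (δ : ℝ) (hδ0 : 0 < δ) (hδ1 : δ < 1)
    (E : Finset (Finset V)) (hunif : ∀ e ∈ E, e.card = k)
    (B : Finset V) (h : Finset V) (hh : h ∈ E) (hhB : h ⊆ B)
    (huniq : ∀ e ∈ E, e ⊆ B → e = h)
    (t : ℕ) (ht : 2 * Real.log (2 / δ) / M ^ 2 ≤ (t : ℝ))
    -- `p̂ g` is the fraction of the `t` independent Bernoulli tests on `B`
    -- (the `i`-th test is the subset `{v ∈ B | g i v = true}`) that detect a hyperedge.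
    (phat : (Fin t → V → Bool) → ℝ)
    (hphat : ∀ g, phat g =
      (Nat.card {i : Fin t // ∃ e ∈ E, e ⊆ B ∧ ∀ v ∈ e, g i v = true} : ℝ) / t) :
    1 - ENNReal.ofReal δ ≤
      Measure.pi (fun _ : Fin t => bernoulliProduct V (Real.exp (-(1 / (k : ℝ)))))
        {g | 0 < phat g ∧ phat g < 1 / Real.exp 1 + M / 2} := by
  have hk0 : (k : ℝ) ≠ 0 := by positivity
  set r : ℝ := Real.exp (-(1 / (k : ℝ))) with hr
  have hr0 : 0 < r := Real.exp_pos _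
  have hr1 : r < 1 := Real.exp_lt_one_iff.2 (neg_lt_zero.2 (by positivity))
  have hrk : r ^ k = 1 / Real.exp 1 := by
    rw [hr, ← Real.exp_nat_mul, one_div (Real.exp 1), ← Real.exp_neg]
    congr 1
    field_simp
  have he : 0 < 1 / Real.exp 1 := by positivity
  have hM0 : 0 < M := hM ▸ mul_pos he (sub_pos.2 hr1)
  have hMe : M < 1 / Real.exp 1 := by
    rw [hM]
    nlinarith
  have hlog : 0 < Real.log (2 / δ) := Real.log_pos (by rw [lt_div_iff₀ hδ0]; linarith)
  have ht0 : 0 < (t : ℝ) := lt_of_lt_of_le (by positivity) ht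
  have := isProbabilityMeasure_bernoulliProduct V hr0.le hr1.le
  set A : Set (V → Bool) := {s | ∀ v ∈ h, s v = true} with hA
  have hAr : (bernoulliProduct V r).real A = 1 / Real.exp 1 := by
    rw [hA, bernoulliProduct_real_forall_mem hr0.le hr1.le, hunif h hh, hrk]
  have hdetect : ∀ s : V → Bool, (∃ e ∈ E, e ⊆ B ∧ ∀ v ∈ e, s v = true) ↔ s ∈ A := by
    refine fun s => ⟨?_, fun hs => ⟨h, hh, hhB, hs⟩⟩
    rintro ⟨e, heE, heB, hes⟩
    rwa [huniq e heE heB] at hes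
  have htail := measureReal_pi_card_tails_le (bernoulliProduct V r)
    (MeasurableSet.of_discrete (s := A)) t (half_pos hM0).le
  have hexp : 2 * Real.exp (-(2 * t * (M / 2) ^ 2)) ≤ δ := by
    have hle : -(2 * t * (M / 2) ^ 2) ≤ -Real.log (2 / δ) := by
      rw [div_le_iff₀ (by positivity)] at ht
      linarith
    calc 2 * Real.exp (-(2 * t * (M / 2) ^ 2)) ≤ 2 * Real.exp (-Real.log (2 / δ)) := by gcongr
      _ = δ := by
        rw [Real.exp_neg, Real.exp_log (by positivity)]
        field_simp
  have hbad := (measureReal_mono (μ := Measure.pi fun _ : Fin t => bernoulliProduct V r)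
    (s₁ := {g | 0 < phat g ∧ phat g < 1 / Real.exp 1 + M / 2}ᶜ) (fun g hg => ?_)).trans
    (htail.trans hexp)
  · rw [tsub_le_iff_right]
    calc (1 : ENNReal) = Measure.pi (fun _ : Fin t => bernoulliProduct V r) Set.univ := by simp
      _ ≤ _ := measure_univ_le_add_compl _
      _ ≤ _ := by
        gcongr
        rw [← ofReal_measureReal]
        exact ENNReal.ofReal_le_ofReal hbad
  · simp only [Set.mem_compl_iff, Set.mem_ofPred_eq, hphat, hdetect, not_and_or, not_lt] at hg
    rw [Set.mem_ofPred_eq, hAr]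
    refine hg.imp (fun hg => ?_) fun hg => ?_
    · rw [div_le_iff₀ ht0, zero_mul] at hg
      exact hg.trans (mul_nonneg ht0.le (by linarith))
    · rwa [le_div_iff₀ ht0, mul_comm] at hg
end

section
/- Let n ≥ k ≥ 1, let N = C(n,k), let q ∈ (0, 1/2], and let G be a random k-uniform hypergraph on n vertices whose edge set E is a random subset of the N possible k-element vertex subsets, each included independently with probability q. Let ε ∈ (0,1), let t ∈ ℕ, let f be any function from edge sets to Boolean vectors of length t, and let g be any function from Boolean vectors of length t to edge sets. Then Pr[g(f(E)) = E] ≤ Pr[|E| < (1−ε)·N·q] + 2^t·(1−q)^N·(q/(1−q))^{(1−ε)·N·q}, where the last exponent is a real power. -/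
open MeasureTheory

/-- The number of hyperedges of the hypergraph whose edge-indicator is `e`. -/
def edgeCount (n k : ℕ) (e : {s : Finset (Fin n) // s.card = k} → Bool) : ℕ :=
  (Finset.univ.filter fun s : {s : Finset (Fin n) // s.card = k} => e s = true).card

lemma bernoulliMeasure_singleton (q : ℝ) (b : Bool) :
    bernoulliMeasure q {b} = ENNReal.ofReal (if b = true then q else 1 - q) := by
  cases b <;> simp [bernoulliMeasure, ENNReal.ofReal]

lemma bernoulliProduct_singleton {V : Type*} [Fintype V] {q : ℝ} (hq0 : 0 ≤ q) (hq1 : q < 1)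
    (e : V → Bool) :
    bernoulliProduct V q {e} = ENNReal.ofReal ((1 - q) ^ Fintype.card V *
      (q / (1 - q)) ^ (Finset.univ.filter fun s => e s = true).card) := by
  have h1 : 0 < 1 - q := by linarith
  rw [bernoulliProduct, Measure.pi_singleton]
  simp_rw [bernoulliMeasure_singleton]
  rw [← ENNReal.ofReal_prod_of_nonneg (fun i _ => by split_ifs <;> linarith)]
  congr 1
  have h : ∀ s, (if e s = true then q else 1 - q) =
      (1 - q) * (if e s = true then q / (1 - q) else 1) := by
    intro s
    split_ifs
    · field_simp
    · ring
  simp_rw [h]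
  rw [Finset.prod_mul_distrib, Finset.prod_const, Finset.card_univ, ← Finset.prod_filter,
    Finset.prod_const]

/-- Edge sets with at least `x` elements that are fixed points of a map factoring through a
finite type `B` have total probability at most `|B|` times that of an edge set of size `x`. -/
lemma bernoulliProduct_fixedPoints_le {V B : Type*} [Fintype V] [Fintype B] {q : ℝ}
    (hq0 : 0 < q) (hq1 : q ≤ 1 / 2) (x : ℝ) (f : (V → Bool) → B) (g : B → V → Bool) :
    bernoulliProduct V q
        {e | g (f e) = e ∧ x ≤ ((Finset.univ.filter fun s => e s = true).card : ℝ)} ≤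
      ENNReal.ofReal (Fintype.card B * (1 - q) ^ Fintype.card V * (q / (1 - q)) ^ x) := by
  classical
  have h1 : 0 < 1 - q := by linarith
  have hr0 : 0 < q / (1 - q) := by positivity
  have hr1 : q / (1 - q) ≤ 1 := by rw [div_le_one h1]; linarith
  set c : ℝ := (1 - q) ^ Fintype.card V * (q / (1 - q)) ^ x with hc
  let S : Finset (V → Bool) := (Finset.univ.image g).filter fun e =>
    x ≤ ((Finset.univ.filter fun s => e s = true).card : ℝ)
  calc bernoulliProduct V q
        {e | g (f e) = e ∧ x ≤ ((Finset.univ.filter fun s => e s = true).card : ℝ)}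
      ≤ bernoulliProduct V q (⋃ e ∈ S, {e}) := by
        refine measure_mono fun e he => ?_
        simp only [Set.mem_iUnion, Set.mem_singleton_iff, exists_prop, exists_eq_right']
        exact Finset.mem_filter.2
          ⟨Finset.mem_image.2 ⟨f e, Finset.mem_univ _, he.1⟩, he.2⟩
    _ ≤ ∑ e ∈ S, bernoulliProduct V q {e} := measure_biUnion_finset_le _ _
    _ ≤ ∑ _e ∈ S, ENNReal.ofReal c := by
        refine Finset.sum_le_sum fun e he => ?_
        rw [bernoulliProduct_singleton hq0.le (by linarith)]
        refine ENNReal.ofReal_le_ofReal ?_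
        rw [hc, ← Real.rpow_natCast (q / (1 - q))]
        exact mul_le_mul_of_nonneg_left
          (Real.rpow_le_rpow_of_exponent_ge hr0 hr1 (Finset.mem_filter.1 he).2) (by positivity)
    _ = S.card * ENNReal.ofReal c := by rw [Finset.sum_const, nsmul_eq_mul]
    _ ≤ Fintype.card B * ENNReal.ofReal c := by
        gcongr
        exact (Finset.card_filter_le _ _).trans Finset.card_image_le
    _ = ENNReal.ofReal (Fintype.card B * (1 - q) ^ Fintype.card V * (q / (1 - q)) ^ x) := by
        rw [mul_assoc, ← hc, ENNReal.ofReal_mul (Nat.cast_nonneg _), ENNReal.ofReal_natCast]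

/-- counting bound for any non-adaptive design `f` with `t` binary
queries and any decoder `g` on a `G⁽ᵏ⁾(n,q)` random hypergraph. -/
theorem stmt13 (n k : ℕ) (hk : 1 ≤ k) (hkn : k ≤ n)
    (N : ℕ) (hN : N = n.choose k)
    (q : ℝ) (hq0 : 0 < q) (hq1 : q ≤ 1 / 2)
    (ε : ℝ) (hε0 : 0 < ε) (hε1 : ε < 1) (t : ℕ)
    (f : ({s : Finset (Fin n) // s.card = k} → Bool) → (Fin t → Bool))
    (g : (Fin t → Bool) → ({s : Finset (Fin n) // s.card = k} → Bool)) :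
    bernoulliProduct {s : Finset (Fin n) // s.card = k} q {e | g (f e) = e} ≤
      bernoulliProduct {s : Finset (Fin n) // s.card = k} q
          {e | (edgeCount n k e : ℝ) < (1 - ε) * ((N : ℝ) * q)} +
        ENNReal.ofReal
          (2 ^ t * (1 - q) ^ N * (q / (1 - q)) ^ ((1 - ε) * ((N : ℝ) * q))) := by
  have hV : Fintype.card {s : Finset (Fin n) // s.card = k} = N := by
    rw [hN, Fintype.card_finset_len, Fintype.card_fin]
  have hB : (Fintype.card (Fin t → Bool) : ℝ) = 2 ^ t := by simp
  have key := bernoulliProduct_fixedPoints_le hq0 hq1 ((1 - ε) * ((N : ℝ) * q)) f g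
  rw [hV, hB] at key
  refine le_trans (le_trans (measure_mono fun e he => ?_) (measure_union_le _ _))
    (add_le_add le_rfl key)
  rcases lt_or_ge (edgeCount n k e : ℝ) ((1 - ε) * ((N : ℝ) * q)) with h | h
  · exact Or.inl h
  · exact Or.inr ⟨he, h⟩
end

section
/- Fix an integer k ≥ 1 and a real η ∈ (0,1). For each n, let N_n = C(n,k), let q_n ∈ (0, 1/2] with q_n → 0 and N_n·q_n → ∞, let t_n ∈ ℕ satisfy t_n ≤ (1−η)·N_n·q_n·log₂(1/q_n), let E_n be a random subset of the N_n possible k-element vertex subsets with independent inclusion probability q_n, let f_n be any function from edge sets to Boolean vectors of length t_n, and let g_n be any function from Boolean vectors of length t_n to edge sets. Then Pr[g_n(f_n(E_n)) = E_n] → 0 as n → ∞. In particular, to learn a G^{(k)}(n,q) hypergraph non-adaptively with vanishing error probability one needs at least (m̄·log₂(1/q))·(1−η) queries, where m̄ = C(n,k)·q. -/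
open MeasureTheory

open Filter

/-- The mass that the Bernoulli(r) measure on `Bool` gives to a single outcome. -/
noncomputable def bernoulliWeight (r : ℝ) (b : Bool) : ℝ := if b then r else 1 - r

lemma bernoulliWeight_nonneg {r : ℝ} (h0 : 0 ≤ r) (h1 : r ≤ 1) (b : Bool) :
    0 ≤ bernoulliWeight r b := by
  cases b <;> simp [bernoulliWeight, h0, h1]

lemma bernoulliMeasure_singleton_s14 (r : ℝ) (b : Bool) :
    bernoulliMeasure r {b} = ENNReal.ofReal (bernoulliWeight r b) := by
  cases b <;> simp [bernoulliMeasure, bernoulliWeight, ENNReal.ofReal]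

lemma bernoulliProduct_coe_finset {V : Type*} [Fintype V] {r : ℝ} (h0 : 0 ≤ r) (h1 : r ≤ 1)
    (S : Finset (V → Bool)) :
    bernoulliProduct V r (S : Set (V → Bool)) =
      ENNReal.ofReal (∑ e ∈ S, ∏ v, bernoulliWeight r (e v)) := by
  have hw := bernoulliWeight_nonneg h0 h1
  rw [← sum_measure_singleton, ENNReal.ofReal_sum_of_nonneg
    fun e _ => Finset.prod_nonneg fun v _ => hw (e v)]
  refine Finset.sum_congr rfl fun e _ => ?_
  rw [ENNReal.ofReal_prod_of_nonneg fun v _ => hw (e v), bernoulliProduct, Measure.pi_singleton]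
  simp_rw [bernoulliMeasure_singleton_s14]

/-- The moment generating function of a binomial variable, bounded by that of a Poisson one. -/
lemma sum_bernoulliWeight_mul_exp_le {V : Type*} [Fintype V] [DecidableEq V] {r : ℝ}
    (h0 : 0 ≤ r) (h1 : r ≤ 1) (s : ℝ) :
    ∑ e : V → Bool, (∏ v, bernoulliWeight r (e v)) *
        Real.exp (-s * (Finset.univ.filter fun v => e v = true).card) ≤
      Real.exp (-(Fintype.card V * r * (1 - Real.exp (-s)))) := by
  have hterm : ∀ e : V → Bool, (∏ v, bernoulliWeight r (e v)) *
      Real.exp (-s * (Finset.univ.filter fun v => e v = true).card) =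
      ∏ v, (bernoulliWeight r (e v) * if e v then Real.exp (-s) else 1) := by
    intro e
    rw [Finset.prod_mul_distrib, Finset.prod_ite, Finset.prod_const, Finset.prod_const_one,
      mul_one, ← Real.exp_nat_mul, mul_comm (-s)]
  simp_rw [hterm]
  rw [← Fintype.piFinset_univ, ← Finset.prod_univ_sum (fun _ : V => Finset.univ)
    fun _ b => bernoulliWeight r b * if b then Real.exp (-s) else 1]
  simp only [bernoulliWeight, Fintype.sum_bool, if_true, Bool.false_eq_true, if_false, mul_one,
    Finset.prod_const, Finset.card_univ]
  have hb : r * Real.exp (-s) + (1 - r) ≤ Real.exp (-(r * (1 - Real.exp (-s)))) := by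
    have := Real.add_one_le_exp (-(r * (1 - Real.exp (-s))))
    linarith
  calc _ ≤ Real.exp (-(r * (1 - Real.exp (-s)))) ^ Fintype.card V :=
        pow_le_pow_left₀ (add_nonneg (by positivity) (by linarith)) hb _
    _ = _ := by rw [← Real.exp_nat_mul]; ring_nf

lemma prod_bernoulliWeight_le_rpow {V : Type*} [Fintype V] {r : ℝ} (h0 : 0 < r) (h1 : r ≤ 1)
    {a : ℝ} (e : V → Bool) (ha : a ≤ (Finset.univ.filter fun v => e v = true).card) :
    ∏ v, bernoulliWeight r (e v) ≤ r ^ a := by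
  calc ∏ v, bernoulliWeight r (e v) ≤ ∏ v, (if e v = true then r else 1) := by
        refine Finset.prod_le_prod (fun v _ => bernoulliWeight_nonneg h0.le h1 _) fun v _ => ?_
        unfold bernoulliWeight
        split_ifs <;> linarith
    _ = r ^ ((Finset.univ.filter fun v => e v = true).card : ℝ) := by
        rw [Finset.prod_ite, Finset.prod_const, Finset.prod_const_one, mul_one, Real.rpow_natCast]
    _ ≤ r ^ a := Real.rpow_le_rpow_of_exponent_ge h0 h1 ha

/-- The success probability of `t` binary queries is at most the Chernoff bound for the event of
having fewer than `a` successes, plus `2 ^ t` times the largest mass `r ^ a` of other outcomes. -/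
lemma bernoulliProduct_decoded_le {V : Type*} [Fintype V] {r : ℝ} (h0 : 0 < r) (h1 : r ≤ 1)
    {t : ℕ} (f : (V → Bool) → (Fin t → Bool)) (g : (Fin t → Bool) → (V → Bool))
    {s : ℝ} (hs : 0 ≤ s) (a : ℝ) :
    bernoulliProduct V r {e | g (f e) = e} ≤ ENNReal.ofReal
      (Real.exp (s * a - Fintype.card V * r * (1 - Real.exp (-s))) + 2 ^ t * r ^ a) := by
  classical
  set S : Finset (V → Bool) := Finset.univ.filter fun e => g (f e) = e with hS
  have hcoe : {e | g (f e) = e} = (S : Set (V → Bool)) := by ext; simp [hS]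
  have hcard : (S.card : ℝ) ≤ 2 ^ t := by
    have : S.card ≤ (Finset.univ : Finset (Fin t → Bool)).card := by
      refine Finset.card_le_card_of_injOn f (fun _ _ => Finset.mem_coe.2 (Finset.mem_univ _)) ?_
      intro x hx y hy hxy
      simp only [hS, Finset.coe_filter, Finset.mem_univ, true_and, Set.mem_ofPred_eq] at hx hy
      rw [← hx, ← hy, hxy]
    have h2 : S.card ≤ 2 ^ t := by simpa using this
    exact_mod_cast h2
  rw [hcoe, bernoulliProduct_coe_finset h0.le h1]
  refine ENNReal.ofReal_le_ofReal ?_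
  set p : (V → Bool) → ℝ := fun e => ∏ v, bernoulliWeight r (e v)
  set w : (V → Bool) → ℝ := fun e => (Finset.univ.filter fun v => e v = true).card
  have hp : ∀ e, 0 ≤ p e := fun e =>
    Finset.prod_nonneg fun v _ => bernoulliWeight_nonneg h0.le h1 _
  have hra : 0 ≤ r ^ a := by positivity
  have hpoint : ∀ e, p e ≤ Real.exp (s * a) * (p e * Real.exp (-s * w e)) + r ^ a := by
    intro e
    rcases le_total a (w e) with h | h
    · have := prod_bernoulliWeight_le_rpow h0 h1 e h
      have : 0 ≤ Real.exp (s * a) * (p e * Real.exp (-s * w e)) :=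
        mul_nonneg (Real.exp_nonneg _) (mul_nonneg (hp e) (Real.exp_nonneg _))
      linarith
    · have h1 : 1 ≤ Real.exp (s * a) * Real.exp (-s * w e) := by
        rw [← Real.exp_add]
        exact Real.one_le_exp (by nlinarith)
      nlinarith [mul_le_mul_of_nonneg_left h1 (hp e)]
  calc ∑ e ∈ S, p e
      ≤ ∑ e ∈ S, (Real.exp (s * a) * (p e * Real.exp (-s * w e)) + r ^ a) :=
        Finset.sum_le_sum fun e _ => hpoint e
    _ = Real.exp (s * a) * ∑ e ∈ S, p e * Real.exp (-s * w e) + S.card * r ^ a := by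
        rw [Finset.sum_add_distrib, Finset.mul_sum, Finset.sum_const, nsmul_eq_mul]
    _ ≤ Real.exp (s * a) * Real.exp (-(Fintype.card V * r * (1 - Real.exp (-s)))) +
          2 ^ t * r ^ a := by
        gcongr
        refine le_trans ?_ (sum_bernoulliWeight_mul_exp_le h0.le h1 s)
        exact Finset.sum_le_sum_of_subset_of_nonneg (Finset.subset_univ _)
          fun e _ _ => mul_nonneg (hp e) (Real.exp_nonneg _)
    _ = _ := by rw [← Real.exp_add]; ring_nf

lemma mul_one_sub_lt_one_sub_exp_neg {ε : ℝ} (hε : 0 < ε) :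
    ε * (1 - ε) < 1 - Real.exp (-ε) := by
  have h1 := Real.add_one_lt_exp hε.ne'
  have h2 : Real.exp (-ε) * Real.exp ε = 1 := by rw [← Real.exp_add]; simp
  have h3 := Real.exp_pos (-ε)
  have h4 : Real.exp (-ε) * (ε + 1) < 1 := by nlinarith
  nlinarith [mul_pos hε (mul_pos hε hε)]

/-- A query budget with a `1 - η` factor cannot beat masses with a `1 - η / 2` factor. -/
lemma two_pow_mul_rpow_le {m r η : ℝ} {t : ℕ} (hm : 0 ≤ m) (hη : 0 ≤ η) (h0 : 0 < r)
    (h1 : r ≤ 1 / 2) (ht : (t : ℝ) ≤ (1 - η) * m * Real.logb 2 (1 / r)) :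
    2 ^ t * r ^ ((1 - η / 2) * m) ≤ Real.exp (-(η / 2 * Real.log 2 * m)) := by
  have hlog2 : 0 < Real.log 2 := Real.log_pos one_lt_two
  have hlogr : Real.log r ≤ -Real.log 2 := by
    have := Real.log_le_log h0 h1
    rwa [one_div, Real.log_inv] at this
  have ht' : Real.log 2 * t ≤ -((1 - η) * m * Real.log r) := by
    rw [one_div, Real.logb_inv, Real.logb] at ht
    calc Real.log 2 * t
        ≤ Real.log 2 * ((1 - η) * m * -(Real.log r / Real.log 2)) := by gcongr
      _ = _ := by field_simp
  rw [← Real.rpow_natCast, Real.rpow_def_of_pos two_pos, Real.rpow_def_of_pos h0, ← Real.exp_add]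
  refine Real.exp_le_exp.2 ?_
  nlinarith [mul_le_mul_of_nonneg_left hlogr (mul_nonneg hη hm)]

/-- lower bound: any sequence of non-adaptive designs with
`tₙ ≤ (1−η)·Nₙ·qₙ·log₂(1/qₙ)` queries has success probability tending to 0,
i.e. learning `G⁽ᵏ⁾(n,q)` non-adaptively with vanishing error requires at least
`(m̄·log₂(1/q))·(1−η)` queries. -/
theorem stmt14 (k : ℕ) (hk : 1 ≤ k) (η : ℝ) (hη0 : 0 < η) (hη1 : η < 1)
    (N : ℕ → ℕ) (hN : ∀ n, N n = n.choose k)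
    (q : ℕ → ℝ) (hq0 : ∀ n, 0 < q n) (hq1 : ∀ n, q n ≤ 1 / 2)
    (hqto0 : Tendsto q atTop (nhds 0))
    (hNq : Tendsto (fun n => (N n : ℝ) * q n) atTop atTop)
    (t : ℕ → ℕ)
    (ht : ∀ n, (t n : ℝ) ≤ (1 - η) * ((N n : ℝ) * q n) * Real.logb 2 (1 / q n))
    (f : ∀ n : ℕ, ({s : Finset (Fin n) // s.card = k} → Bool) → (Fin (t n) → Bool))
    (g : ∀ n : ℕ, (Fin (t n) → Bool) → ({s : Finset (Fin n) // s.card = k} → Bool)) :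
    Tendsto
      (fun n : ℕ => bernoulliProduct {s : Finset (Fin n) // s.card = k} (q n)
        {e | g n (f n e) = e})
      atTop (nhds 0) := by
  set ε := η / 2 with hε
  have hε0 : 0 < ε := by positivity
  have hcard : ∀ n, (Fintype.card {s : Finset (Fin n) // s.card = k} : ℝ) = N n := by
    intro n
    rw [hN, Fintype.card_finset_len, Fintype.card_fin]
  have hdecay : ∀ c : ℝ, 0 < c →
      Tendsto (fun n => Real.exp (-(c * ((N n : ℝ) * q n)))) atTop (nhds 0) := fun c hc =>
    Real.tendsto_exp_neg_atTop_nhds_zero.comp (hNq.const_mul_atTop hc)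
  have hbound := (hdecay (1 - Real.exp (-ε) - ε * (1 - ε))
    (sub_pos.2 (mul_one_sub_lt_one_sub_exp_neg hε0))).add
    (hdecay (ε * Real.log 2) (mul_pos hε0 (Real.log_pos one_lt_two)))
  rw [add_zero] at hbound
  have hlim := ENNReal.tendsto_ofReal hbound
  rw [ENNReal.ofReal_zero] at hlim
  refine tendsto_of_tendsto_of_tendsto_of_le_of_le tendsto_const_nhds hlim
    (fun _ => zero_le) fun n => ?_
  refine (bernoulliProduct_decoded_le (hq0 n) ((hq1 n).trans (by norm_num)) (f n) (g n) hε0.le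
    ((1 - ε) * ((N n : ℝ) * q n))).trans (ENNReal.ofReal_le_ofReal (add_le_add ?_ ?_))
  · rw [hcard]
    exact le_of_eq (by ring_nf)
  · exact two_pow_mul_rpow_le (mul_nonneg (Nat.cast_nonneg _) (hq0 n).le) hη0.le (hq0 n)
      (hq1 n) (ht n)
end

section
/- Let V be a finite set of n vertices, k ≥ 1, and E a set of k-element subsets of V with maximum degree Δ. Let p ∈ [0,1], let X_1, …, X_t be independent Bernoulli(p) random subsets of V, let Y_i = 1 iff some hyperedge of E is contained in X_i, and let Ê be the COMP estimate: the set of all k-element subsets h of V such that for every i with Y_i = 0 one has ¬(h ⊆ X_i). Let P_G := Pr[some hyperedge e ∈ E satisfies e ⊆ X_1]. Then Pr[Ê ≠ E] ≤ C(n,k)·(1 − p^k·(1 − k·Δ·p − P_G))^t. -/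
open MeasureTheory

/-- The COMP estimate from `t` Bernoulli query sets `Xᵢ = {v | g i v = true}`:
all `k`-element subsets of `V` not contained in any negatively answered query. -/
def compEstimate {V : Type*} (E : Finset (Finset V)) (k t : ℕ)
    (g : Fin t → V → Bool) : Set (Finset V) :=
  {h : Finset V | h.card = k ∧
    ∀ i, ¬ (∃ e ∈ E, ∀ v ∈ e, g i v = true) → ¬ ∀ v ∈ h, g i v = true}

lemma isProbabilityMeasure_bernoulliMeasure_s17 {p : ℝ} (hp0 : 0 ≤ p) (hp1 : p ≤ 1) :
    IsProbabilityMeasure (bernoulliMeasure p) := by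
  constructor
  have h : p.toNNReal + (1 - p).toNNReal = 1 := by
    rw [← Real.toNNReal_add hp0 (sub_nonneg.2 hp1)]
    simp
  simp only [bernoulliMeasure, Measure.coe_add, Measure.coe_nnreal_smul_apply, Pi.add_apply,
    measure_univ, mul_one]
  exact_mod_cast h

lemma isProbabilityMeasure_bernoulliProduct_s17 (V : Type*) [Fintype V] {p : ℝ}
    (hp0 : 0 ≤ p) (hp1 : p ≤ 1) : IsProbabilityMeasure (bernoulliProduct V p) := by
  have := isProbabilityMeasure_bernoulliMeasure_s17 hp0 hp1
  unfold bernoulliProduct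
  infer_instance

/-- A random subset contains a fixed set `s` with probability `p ^ #s`. -/
lemma bernoulliProduct_real_superset {V : Type*} [Fintype V] [DecidableEq V] {p : ℝ}
    (hp0 : 0 ≤ p) (hp1 : p ≤ 1) (s : Finset V) :
    (bernoulliProduct V p).real {f | ∀ v ∈ s, f v = true} = p ^ s.card := by
  have := isProbabilityMeasure_bernoulliMeasure_s17 hp0 hp1
  have hs : {f : V → Bool | ∀ v ∈ s, f v = true} =
      Set.univ.pi fun v => if v ∈ s then {true} else Set.univ := by
    ext f
    simp only [Set.mem_ofPred_eq, Set.mem_pi, Set.mem_univ, true_implies]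
    refine forall_congr' fun v => ?_
    by_cases hv : v ∈ s <;> simp [hv]
  have hv : ∀ v, bernoulliMeasure p (if v ∈ s then {true} else Set.univ) =
      if v ∈ s then ENNReal.ofReal p else 1 := by
    intro v
    split_ifs
    · simp [bernoulliMeasure, ENNReal.ofReal]
    · exact measure_univ
  rw [measureReal_def, hs, bernoulliProduct, Measure.pi_pi]
  simp only [hv, Finset.prod_ite_mem, Finset.univ_inter, Finset.prod_const]
  simp [hp0]

/-- Containing `h` is independent of containing some edge disjoint from `h`. -/
lemma bernoulliProduct_real_inter_disjoint {V : Type*} [Fintype V] [DecidableEq V] {p : ℝ}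
    (hp0 : 0 ≤ p) (hp1 : p ≤ 1) (E : Finset (Finset V)) (h : Finset V) :
    (bernoulliProduct V p).real ({f | ∀ v ∈ h, f v = true} ∩
        {f | ∃ e ∈ E, Disjoint e h ∧ ∀ v ∈ e, f v = true}) =
      p ^ h.card *
        (bernoulliProduct V p).real {f | ∃ e ∈ E, Disjoint e h ∧ ∀ v ∈ e, f v = true} := by
  have := isProbabilityMeasure_bernoulliMeasure_s17 hp0 hp1
  have hind : ProbabilityTheory.iIndepFun (fun (v : V) (f : V → Bool) => f v) (bernoulliProduct V p) :=
    ProbabilityTheory.iIndepFun_pi (X := fun _ b => b) fun _ => aemeasurable_id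
  have hfin := hind.indepFun_finset h hᶜ disjoint_compl_right fun v => measurable_pi_apply v
  have key := hfin.measure_inter_preimage_eq_mul {x | ∀ v, x v = true}
    {x | ∃ e ∈ E, Disjoint e h ∧ ∀ v (hv : v ∈ hᶜ), v ∈ e → x ⟨v, hv⟩ = true}
    (Set.toFinite _).measurableSet (Set.toFinite _).measurableSet
  have hA : (fun (f : V → Bool) (v : h) => f v) ⁻¹' {x | ∀ v, x v = true} =
      {f | ∀ v ∈ h, f v = true} := by
    ext f
    simp
  have hB : (fun (f : V → Bool) (v : (hᶜ : Finset V)) => f v) ⁻¹'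
      {x | ∃ e ∈ E, Disjoint e h ∧ ∀ v (hv : v ∈ hᶜ), v ∈ e → x ⟨v, hv⟩ = true} =
      {f | ∃ e ∈ E, Disjoint e h ∧ ∀ v ∈ e, f v = true} := by
    ext f
    simp only [Set.mem_preimage, Set.mem_ofPred_eq]
    refine exists_congr fun e => and_congr_right fun _ => and_congr_right fun hd => ?_
    exact ⟨fun H v hv => H v (Finset.mem_compl.2 (Finset.disjoint_left.1 hd hv)) hv,
      fun H v _ hv => H v hv⟩
  rw [hA, hB] at key
  rw [← bernoulliProduct_real_superset hp0 hp1 h]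
  simp only [measureReal_def, key, ENNReal.toReal_mul]

/-- At most `#h * Δ` edges meet `h`. -/
lemma card_filter_not_disjoint_le {V : Type*} [Fintype V] [DecidableEq V]
    (E : Finset (Finset V)) (h : Finset V) :
    (E.filter fun e => ¬ Disjoint e h).card ≤ h.card * maxDegree E := by
  calc (E.filter fun e => ¬ Disjoint e h).card
      ≤ (h.biUnion fun v => E.filter fun e => v ∈ e).card := by
        refine Finset.card_le_card fun e he => ?_
        obtain ⟨heE, hd⟩ := Finset.mem_filter.1 he
        obtain ⟨v, hve, hvh⟩ := Finset.not_disjoint_iff.1 hd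
        exact Finset.mem_biUnion.2 ⟨v, hvh, Finset.mem_filter.2 ⟨heE, hve⟩⟩
    _ ≤ h.card * maxDegree E := by
        refine Finset.card_biUnion_le_card_mul _ _ _ fun v _ => ?_
        exact Finset.le_sup (f := fun v => (E.filter fun e => v ∈ e).card) (Finset.mem_univ v)

/-- A single test eliminates a fixed non-edge with probability at least
`p ^ k * (1 - k * Δ * p - P_G)`. -/
lemma le_bernoulliProduct_real_eliminate {V : Type*} [Fintype V] [DecidableEq V] {p : ℝ}
    (hp0 : 0 ≤ p) (hp1 : p ≤ 1) {k : ℕ} {E : Finset (Finset V)} (hunif : ∀ e ∈ E, e.card = k)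
    {h : Finset V} (hk : h.card = k) (hE : h ∉ E) :
    p ^ k * (1 - k * maxDegree E * p -
        (bernoulliProduct V p).real {f | ∃ e ∈ E, ∀ v ∈ e, f v = true}) ≤
      (bernoulliProduct V p).real
        {f | (∀ v ∈ h, f v = true) ∧ ¬ ∃ e ∈ E, ∀ v ∈ e, f v = true} := by
  have := isProbabilityMeasure_bernoulliProduct_s17 V hp0 hp1
  set μ := bernoulliProduct V p
  set A := {f : V → Bool | (∀ v ∈ h, f v = true) ∧ ¬ ∃ e ∈ E, ∀ v ∈ e, f v = true}
  set H := {f : V → Bool | ∀ v ∈ h, f v = true}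
  set D := {f : V → Bool | ∃ e ∈ E, Disjoint e h ∧ ∀ v ∈ e, f v = true}
  set F := E.filter fun e => ¬ Disjoint e h
  set U := ⋃ e ∈ F, {f : V → Bool | ∀ v ∈ h ∪ e, f v = true}
  have hcover : H ⊆ A ∪ (U ∪ H ∩ D) := by
    intro f hf
    by_cases hex : ∃ e ∈ E, ∀ v ∈ e, f v = true
    · obtain ⟨e, he, hef⟩ := hex
      by_cases hd : Disjoint e h
      · exact Or.inr (Or.inr ⟨hf, e, he, hd, hef⟩)
      · refine Or.inr (Or.inl (Set.mem_biUnion (Finset.mem_filter.2 ⟨he, hd⟩) fun v hv => ?_))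
        exact (Finset.mem_union.1 hv).elim (hf v) (hef v)
    · exact Or.inl ⟨hf, hex⟩
  have hU : μ.real U ≤ k * maxDegree E * (p ^ k * p) := by
    calc μ.real U ≤ ∑ e ∈ F, μ.real {f | ∀ v ∈ h ∪ e, f v = true} :=
          measureReal_biUnion_finset_le _ _
      _ ≤ ∑ _e ∈ F, p ^ k * p := by
          refine Finset.sum_le_sum fun e he => ?_
          have heE := (Finset.mem_filter.1 he).1
          rw [bernoulliProduct_real_superset hp0 hp1, ← pow_succ]
          refine pow_le_pow_of_le_one hp0 hp1 ?_
          have hss : h ⊂ h ∪ e := by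
            refine Finset.ssubset_iff_subset_ne.2 ⟨Finset.subset_union_left, fun heq => hE ?_⟩
            have : e = h := Finset.eq_of_subset_of_card_le (heq ▸ Finset.subset_union_right)
              (by rw [hk, hunif e heE])
            exact this ▸ heE
          have := Finset.card_lt_card hss
          omega
      _ ≤ k * maxDegree E * (p ^ k * p) := by
          rw [Finset.sum_const, nsmul_eq_mul]
          have := card_filter_not_disjoint_le E h
          rw [hk] at this
          gcongr
          exact_mod_cast this
  have hD : μ.real D ≤ μ.real {f | ∃ e ∈ E, ∀ v ∈ e, f v = true} :=
    measureReal_mono fun f ⟨e, he, _, hef⟩ => ⟨e, he, hef⟩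
  have hHD : μ.real (H ∩ D) = p ^ k * μ.real D := by
    rw [← hk]
    exact bernoulliProduct_real_inter_disjoint hp0 hp1 E h
  have hH : μ.real H = p ^ k := by
    rw [← hk]
    exact bernoulliProduct_real_superset hp0 hp1 h
  have h1 := (measureReal_mono (μ := μ) hcover).trans (measureReal_union_le _ _)
  have h2 := measureReal_union_le (μ := μ) U (H ∩ D)
  have h3 := mul_le_mul_of_nonneg_left hD (pow_nonneg hp0 k)
  linarith

/-- Every edge survives, so the estimate differs from `E` only if some non-edge survives. -/
lemma exists_not_mem_of_compEstimate_ne {V : Type*} {E : Finset (Finset V)} {k t : ℕ}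
    (hunif : ∀ e ∈ E, e.card = k) {g : Fin t → V → Bool}
    (hne : compEstimate E k t g ≠ (E : Set (Finset V))) :
    ∃ h ∈ compEstimate E k t g, h ∉ E := by
  by_contra! hall
  exact hne (Set.Subset.antisymm hall fun e he =>
    ⟨hunif e he, fun _ hneg hsub => hneg ⟨e, he, hsub⟩⟩)

/-- error bound for COMP with `t` independent Bernoulli(p) tests. -/
theorem stmt17 {V : Type*} [Fintype V] [DecidableEq V] (n : ℕ) (hn : n = Fintype.card V)
    (k : ℕ) (hk : 1 ≤ k)
    (E : Finset (Finset V)) (hunif : ∀ e ∈ E, e.card = k)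
    (Δ : ℕ) (hΔ : Δ = maxDegree E)
    (p : ℝ) (hp0 : 0 ≤ p) (hp1 : p ≤ 1) (t : ℕ)
    (PG : ℝ)
    (hPG : PG = (bernoulliProduct V p {f | ∃ e ∈ E, ∀ v ∈ e, f v = true}).toReal) :
    Measure.pi (fun _ : Fin t => bernoulliProduct V p)
        {g | compEstimate E k t g ≠ (E : Set (Finset V))} ≤
      ENNReal.ofReal
        ((n.choose k : ℝ) * (1 - p ^ k * (1 - (k : ℝ) * Δ * p - PG)) ^ t) := by
  have := isProbabilityMeasure_bernoulliProduct_s17 V hp0 hp1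
  set μ := bernoulliProduct V p
  set b := 1 - p ^ k * (1 - (k : ℝ) * Δ * p - PG) with hb
  let A (h : Finset V) : Set (V → Bool) :=
    {f | (∀ v ∈ h, f v = true) ∧ ¬ ∃ e ∈ E, ∀ v ∈ e, f v = true}
  let N := (Finset.univ.powersetCard k).filter (· ∉ E)
  have hcover : {g | compEstimate E k t g ≠ (E : Set (Finset V))} ⊆
      ⋃ h ∈ N, Set.univ.pi fun _ : Fin t => (A h)ᶜ := by
    intro g hg
    obtain ⟨h, hh, hE⟩ := exists_not_mem_of_compEstimate_ne hunif hg
    refine Set.mem_biUnion (Finset.mem_filter.2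
      ⟨Finset.mem_powersetCard.2 ⟨Finset.subset_univ h, hh.1⟩, hE⟩) ?_
    exact fun i _ hi => hh.2 i hi.2 hi.1
  have hsurvive : ∀ h ∈ N, 0 ≤ b ∧ μ (A h)ᶜ ≤ ENNReal.ofReal b := by
    intro h hh
    obtain ⟨hcard, hE⟩ := Finset.mem_filter.1 hh
    have hle : μ.real (A h)ᶜ ≤ b := by
      have := le_bernoulliProduct_real_eliminate hp0 hp1 hunif
        (Finset.mem_powersetCard.1 hcard).2 hE
      rw [probReal_compl_eq_one_sub (Set.toFinite _).measurableSet, hb, hPG, hΔ]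
      exact sub_le_sub_left this 1
    refine ⟨measureReal_nonneg.trans hle, ?_⟩
    rw [← ofReal_measureReal]
    exact ENNReal.ofReal_le_ofReal hle
  have hNcard : N.card ≤ n.choose k := by
    refine (Finset.card_filter_le _ _).trans ?_
    rw [Finset.card_powersetCard, Finset.card_univ, hn]
  rcases N.eq_empty_or_nonempty with hN | ⟨h₀, hh₀⟩
  · refine (measure_mono hcover).trans ?_
    simp [hN]
  have hb0 := (hsurvive h₀ hh₀).1
  calc Measure.pi (fun _ : Fin t => μ) {g | compEstimate E k t g ≠ (E : Set (Finset V))}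
      ≤ ∑ h ∈ N, Measure.pi (fun _ : Fin t => μ) (Set.univ.pi fun _ => (A h)ᶜ) :=
        (measure_mono hcover).trans (measure_biUnion_finset_le _ _)
    _ ≤ ∑ _h ∈ N, ENNReal.ofReal b ^ t := by
        refine Finset.sum_le_sum fun h hh => ?_
        rw [Measure.pi_pi, Finset.prod_const, Finset.card_univ, Fintype.card_fin]
        exact pow_le_pow_left' (hsurvive h hh).2 t
    _ ≤ ENNReal.ofReal ((n.choose k : ℝ) * b ^ t) := by
        rw [Finset.sum_const, nsmul_eq_mul, ENNReal.ofReal_mul (Nat.cast_nonneg _),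
          ENNReal.ofReal_natCast, ENNReal.ofReal_pow hb0]
        gcongr
end
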